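/- Consider a K-user MIMO interference channel over a probability space (Ω, μ). For each pair (i,j) with 1 ≤ i,j ≤ K, let H_{ij} : Ω → ℂ^{N_i × M_j} be measurable random channel matrices. Let G_i^* : Ω → ℂ^{N_i × d_i} be measurable receive filters with ‖G_i^*‖_F = 1 almost surely, and U_j^* : Ω → ℂ^{M_j × d_j} be measurable perfect-CSIT precoders such that almost surely (G_i^*)^H H_{ij} U_j^* = 0 for all i ≠ j. For every P > 1 and each j let U_j(P) : Ω → ℂ^{M_j × d_j} be a measurable precoder, and set ΔU_j(P) := U_j(P) − U_j^*. Assume: (i) for each j there is β_j ∈ [0,1] with lim_{P→∞} log(E[‖ΔU_j(P)‖_F²]) / log P = −β_j; (ii) E[log(1 + Σ_{j≠i} ‖H_{ij}‖_F²)] < ∞; (iii) for each i, lim_{P→∞} (1/log P) · E[log det(I_{d_i} + P (G_i^*)^H H_{ii} U_i(P) U_i(P)^H H_{ii}^H G_i^*)] = d_i; (iv) all the expectations below exist and are finite. Define the rate R_i(P) := E[log det(I_{d_i} + P · R̄_i(P)^{−1} (G_i^*)^H H_{ii} U_i(P) U_i(P)^H H_{ii}^H G_i^*)], where R̄_i(P)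 := I_{d_i} + P Σ_{j≠i} (G_i^*)^H H_{ij} U_j(P) U_j(P)^H H_{ij}^H G_i^* (all determinants here are of positive-definite Hermitian matrices, hence real and positive). Then for every i, liminf_{P→∞} R_i(P)/log P ≥ d_i · min_{j≠i} β_j. -/

import Mathlib

open Matrix MeasureTheory Filter

/-- Frobenius norm of a complex matrix: `‖A‖_F = sqrt (∑ i j, |A i j|²)`. -/
noncomputable def frobNorm {m n : Type*} [Fintype m] [Fintype n] (A : Matrix m n ℂ) : ℝ :=
  Real.sqrt (∑ i, ∑ j, ‖A i j‖ ^ 2)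

section Determinants

open scoped ComplexOrder MatrixOrder

variable {m n : Type*} [Fintype m] [Fintype n] [DecidableEq m] [DecidableEq n]

lemma Matrix.PosSemidef.det_one_add_eq {C : Matrix n n ℂ} (hC : C.PosSemidef) :
    (1 + C).det = ((∏ i, (1 + hC.1.eigenvalues i) : ℝ) : ℂ) := by
  have h := congrArg (Polynomial.eval (-1 : ℂ)) hC.1.charpoly_eq
  rw [eval_charpoly, Polynomial.eval_prod] at h
  have h1 : scalar n (-1 : ℂ) - C = -(1 + C) := by
    simp [scalar_apply, ← diagonal_neg]
    abel
  have h2 : ∏ i, Polynomial.eval (-1 : ℂ)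
        (Polynomial.X - Polynomial.C (hC.1.eigenvalues i : ℂ)) =
      (-1) ^ Fintype.card n * ∏ i, (1 + (hC.1.eigenvalues i : ℂ)) := by
    rw [← Finset.card_univ, ← Finset.prod_const, ← Finset.prod_mul_distrib]
    refine Finset.prod_congr rfl fun i _ => ?_
    simp
    ring
  have h3 : (-1 : ℂ) ^ Fintype.card n ≠ 0 := pow_ne_zero _ (by simp)
  rw [h1, det_neg] at h
  have h4 := mul_left_cancel₀ h3 (h.trans h2)
  rw [h4]
  push_cast
  rfl

lemma Matrix.PosSemidef.one_le_det_one_add {C : Matrix n n ℂ} (hC : C.PosSemidef) :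
    1 ≤ (1 + C).det := by
  rw [hC.det_one_add_eq]
  have h : (1 : ℝ) ≤ ∏ i, (1 + hC.1.eigenvalues i) :=
    Finset.prod_induction _ (fun x : ℝ => 1 ≤ x) (fun _ _ => one_le_mul_of_one_le_of_one_le) le_rfl
      fun i _ => by linarith [hC.eigenvalues_nonneg i]
  exact_mod_cast h

lemma Matrix.PosSemidef.det_one_add_re_le {C : Matrix n n ℂ} (hC : C.PosSemidef) :
    (1 + C).det.re ≤ (1 + C.trace.re) ^ Fintype.card n := by
  rw [hC.det_one_add_eq, Complex.ofReal_re]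
  have ht : C.trace.re = ∑ i, hC.1.eigenvalues i := by
    rw [hC.1.trace_eq_sum_eigenvalues]
    simp
  rw [ht, ← Finset.card_univ, ← Finset.prod_const]
  refine Finset.prod_le_prod (fun i _ => by linarith [hC.eigenvalues_nonneg i]) fun i hi => ?_
  have := Finset.single_le_sum (f := hC.1.eigenvalues)
    (fun i _ => hC.eigenvalues_nonneg i) hi
  linarith

lemma Matrix.PosDef.det_le_det_add {A B : Matrix n n ℂ} (hA : A.PosDef) (hB : B.PosSemidef) :
    A.det ≤ (A + B).det := by
  obtain ⟨Y, rfl⟩ := CStarAlgebra.nonneg_iff_eq_star_mul_self.mp hB.nonneg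
  have hu : IsUnit A.det := (isUnit_iff_isUnit_det A).mp hA.isUnit
  have hf : A + star Y * Y = A * (1 + (A⁻¹ * Yᴴ) * Y) := by
    rw [mul_add, mul_one, mul_assoc, mul_nonsing_inv_cancel_left _ _ hu]
    rfl
  rw [hf, det_mul, det_one_add_mul_comm]
  have h1 : 1 ≤ (1 + Y * (A⁻¹ * Yᴴ)).det := by
    refine PosSemidef.one_le_det_one_add ?_
    rw [← mul_assoc]
    exact hA.inv.posSemidef.mul_mul_conjTranspose_same Y
  exact le_mul_of_one_le_right hA.det_pos.le h1

lemma Matrix.PosSemidef.one_sub_inv_one_add {A : Matrix n n ℂ} (hA : A.PosSemidef) :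
    (1 - (1 + A)⁻¹).PosSemidef := by
  have hR : (1 + A).PosDef := PosDef.one.add_posSemidef hA
  have hu : IsUnit (1 + A).det := (isUnit_iff_isUnit_det _).mp hR.isUnit
  have hp : (A + A * Aᴴ).PosSemidef := hA.add (posSemidef_self_mul_conjTranspose A)
  have h := hp.mul_mul_conjTranspose_same (1 + A)⁻¹
  convert h using 1
  rw [hR.inv.1.eq, hA.1.eq]
  have : A + A * A = (1 + A) * A := by rw [add_mul, one_mul]
  rw [this, nonsing_inv_mul_cancel_left _ _ hu]
  have h2 : A = (1 + A) - 1 := by abel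
  conv_rhs => rw [h2]
  rw [show (1 + ((1 + A) - 1)) = 1 + A by abel, sub_mul, mul_nonsing_inv _ hu, one_mul]

lemma det_one_add_inv_mul_bounds {A : Matrix n n ℂ} (hA : A.PosSemidef) (Y : Matrix n m ℂ) :
    1 ≤ (1 + (1 + A)⁻¹ * (Y * Yᴴ)).det.re ∧
    (1 + (1 + A)⁻¹ * (Y * Yᴴ)).det.re ≤ (1 + Y * Yᴴ).det.re ∧
    (1 + Y * Yᴴ).det.re ≤ (1 + A).det.re * (1 + (1 + A)⁻¹ * (Y * Yᴴ)).det.re := by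
  have hR : (1 + A).PosDef := PosDef.one.add_posSemidef hA
  have hu : IsUnit (1 + A).det := (isUnit_iff_isUnit_det _).mp hR.isUnit
  have hc : (Yᴴ * (1 + A)⁻¹ * Y).PosSemidef :=
    hR.inv.posSemidef.conjTranspose_mul_mul_same Y
  have e1 : (1 + (1 + A)⁻¹ * (Y * Yᴴ)).det = (1 + Yᴴ * (1 + A)⁻¹ * Y).det := by
    rw [← Matrix.mul_assoc, det_one_add_mul_comm, Matrix.mul_assoc]
  have h1 : 1 ≤ (1 + (1 + A)⁻¹ * (Y * Yᴴ)).det := e1 ▸ hc.one_le_det_one_add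
  have h2 : (1 + (1 + A)⁻¹ * (Y * Yᴴ)).det ≤ (1 + Y * Yᴴ).det := by
    rw [e1, det_one_add_mul_comm Y Yᴴ]
    have := (PosDef.one.add_posSemidef hc).det_le_det_add
      (hA.one_sub_inv_one_add.conjTranspose_mul_mul_same Y)
    convert this using 2
    rw [Matrix.mul_sub, Matrix.sub_mul, Matrix.mul_one]
    abel
  have h3 : (1 + Y * Yᴴ).det ≤ (1 + A).det * (1 + (1 + A)⁻¹ * (Y * Yᴴ)).det := by
    rw [← det_mul, mul_add, mul_one, mul_nonsing_inv_cancel_left _ _ hu]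
    have := (PosDef.one.add_posSemidef (posSemidef_self_mul_conjTranspose Y)).det_le_det_add hA
    convert this using 2
    abel
  have him : (1 + (1 + A)⁻¹ * (Y * Yᴴ)).det.im = 0 := (Complex.le_def.mp h1).2.symm
  refine ⟨by simpa using (Complex.le_def.mp h1).1, (Complex.le_def.mp h2).1, ?_⟩
  have := (Complex.le_def.mp h3).1
  rwa [Complex.mul_re, him, mul_zero, sub_zero] at this

end Determinants

section Frobenius

variable {l m n : Type*} [Fintype l] [Fintype m] [Fintype n]

lemma frobNorm_nonneg (A : Matrix m n ℂ) : 0 ≤ frobNorm A := Real.sqrt_nonneg _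

lemma frobNorm_sq (A : Matrix m n ℂ) : frobNorm A ^ 2 = ∑ i, ∑ j, ‖A i j‖ ^ 2 :=
  Real.sq_sqrt (by positivity)

attribute [local instance] Matrix.frobeniusNormedAddCommGroup in
lemma frobNorm_eq_norm (A : Matrix m n ℂ) : frobNorm A = ‖A‖ := by
  rw [frobenius_norm_def, frobNorm, Real.sqrt_eq_rpow]
  simp

lemma frobNorm_mul_le (A : Matrix l m ℂ) (B : Matrix m n ℂ) :
    frobNorm (A * B) ≤ frobNorm A * frobNorm B := by
  simp only [frobNorm_eq_norm]
  exact frobenius_norm_mul A B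

lemma frobNorm_conjTranspose (A : Matrix m n ℂ) : frobNorm Aᴴ = frobNorm A := by
  simp only [frobNorm_eq_norm]
  exact frobenius_norm_conjTranspose A

lemma trace_mul_conjTranspose_re (A : Matrix m n ℂ) : (A * Aᴴ).trace.re = frobNorm A ^ 2 := by
  rw [frobNorm_sq]
  simp [trace, mul_apply, Complex.mul_conj, Complex.normSq_eq_norm_sq]
  norm_cast

end Frobenius

section Expectation

variable {Ω : Type*} [MeasurableSpace Ω] {μ : Measure Ω}

lemma integrable_log_one_add {X : Ω → ℝ} (hX : Integrable X μ) (h0 : ∀ ω, 0 ≤ X ω) :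
    Integrable (fun ω => Real.log (1 + X ω)) μ := by
  refine hX.mono' ?_ (ae_of_all _ fun ω => ?_)
  · exact (Real.measurable_log.comp_aemeasurable
      (aemeasurable_const.add hX.aemeasurable)).aestronglyMeasurable
  · rw [Real.norm_of_nonneg (Real.log_nonneg (by linarith [h0 ω]))]
    linarith [Real.log_le_sub_one_of_pos (show 0 < 1 + X ω by linarith [h0 ω])]

lemma integral_log_one_add_le [IsProbabilityMeasure μ] {X : Ω → ℝ} (hX : Integrable X μ) (h0 : ∀ ω, 0 ≤ X ω) :
    ∫ ω, Real.log (1 + X ω) ∂μ ≤ Real.log (1 + ∫ ω, X ω ∂μ) := by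
  set c := 1 + ∫ ω, X ω ∂μ with hc
  have hc0 : 0 < c := by
    have : 0 ≤ ∫ ω, X ω ∂μ := integral_nonneg h0
    linarith
  have hle : ∀ ω, Real.log (1 + X ω) ≤ Real.log c - 1 + c⁻¹ + c⁻¹ * X ω := fun ω => by
    have hp : 0 < 1 + X ω := by linarith [h0 ω]
    have := Real.log_le_sub_one_of_pos (div_pos hp hc0)
    rw [Real.log_div hp.ne' hc0.ne', div_eq_inv_mul] at this
    linarith
  have hI : Integrable (fun ω => c⁻¹ * X ω) μ := hX.const_mul _
  refine (integral_mono (g := fun ω => Real.log c - 1 + c⁻¹ + c⁻¹ * X ω)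
    (integrable_log_one_add hX h0) ((integrable_const _).add hI) hle).trans (le_of_eq ?_)
  rw [integral_add (integrable_const _) hI, integral_const, integral_const_mul]
  have : ∫ ω, X ω ∂μ = c - 1 := by rw [hc]; ring
  rw [this]
  simp
  field_simp
  ring

end Expectation

lemma eventually_le_rpow_of_tendsto_log_div_log {e : ℝ → ℝ} {b c : ℝ} (h0 : ∀ P, 0 ≤ e P)
    (h : Tendsto (fun P => Real.log (e P) / Real.log P) atTop (nhds b)) (hc : b < c) :
    ∀ᶠ P in atTop, e P ≤ P ^ c := by
  filter_upwards [h.eventually (eventually_lt_nhds hc), eventually_gt_atTop 1] with P hP h1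
  have hP0 : 0 < P := by linarith
  rcases (h0 P).eq_or_lt with he | he
  · rw [← he]; positivity
  · rw [div_lt_iff₀ (Real.log_pos h1)] at hP
    rw [← Real.log_le_log_iff he (by positivity), Real.log_rpow hP0]
    exact hP.le

section Channel

open scoped ComplexOrder MatrixOrder

variable {ι : Type*} {a n : Type*} {b c : ι → Type*} [Fintype a] [Fintype n]
  [∀ j, Fintype (b j)] [∀ j, Fintype (c j)]

lemma posSemidef_smul_sum_mul_conjTranspose {P : ℝ} (hP : 0 ≤ P) (s : Finset ι)
    (W : ∀ j, Matrix n (c j) ℂ) : ((P : ℂ) • ∑ j ∈ s, W j * (W j)ᴴ).PosSemidef :=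
  (posSemidef_sum s fun j _ => posSemidef_self_mul_conjTranspose (W j)).smul
    (Complex.zero_le_real.mpr hP)

lemma log_det_interference_le [DecidableEq n] {P : ℝ} (hP : 0 ≤ P) (s : Finset ι)
    (G : Matrix a n ℂ) (hG : frobNorm G = 1) (H : ∀ j, Matrix a (b j) ℂ)
    (D : ∀ j, Matrix (b j) (c j) ℂ) :
    Real.log (1 + (P : ℂ) • ∑ j ∈ s, (Gᴴ * H j * D j) * (Gᴴ * H j * D j)ᴴ).det.re ≤
      Fintype.card n * (Real.log (1 + ∑ j ∈ s, frobNorm (H j) ^ 2) +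
        Real.log (1 + P * ∑ j ∈ s, frobNorm (D j) ^ 2)) := by
  have hpsd := posSemidef_smul_sum_mul_conjTranspose hP s fun j => Gᴴ * H j * D j
  have h1 := (Complex.le_def.mp hpsd.one_le_det_one_add).1
  have h2 := hpsd.det_one_add_re_le
  have htr : ((P : ℂ) • ∑ j ∈ s, (Gᴴ * H j * D j) * (Gᴴ * H j * D j)ᴴ).trace.re =
      P * ∑ j ∈ s, frobNorm (Gᴴ * H j * D j) ^ 2 := by
    simp only [trace_smul, trace_sum, smul_eq_mul, Complex.re_ofReal_mul, Complex.re_sum,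
      trace_mul_conjTranspose_re]
  have hW : ∀ j, frobNorm (Gᴴ * H j * D j) ^ 2 ≤ frobNorm (H j) ^ 2 * frobNorm (D j) ^ 2 := by
    intro j
    rw [← mul_pow]
    refine pow_le_pow_left₀ (frobNorm_nonneg _) ((frobNorm_mul_le _ _).trans ?_) 2
    refine mul_le_mul_of_nonneg_right ((frobNorm_mul_le _ _).trans ?_) (frobNorm_nonneg _)
    rw [frobNorm_conjTranspose, hG, one_mul]
  set h := ∑ j ∈ s, frobNorm (H j) ^ 2
  set δ := ∑ j ∈ s, frobNorm (D j) ^ 2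
  have hh : 0 ≤ h := Finset.sum_nonneg fun _ _ => sq_nonneg _
  have hδ : 0 ≤ P * δ := mul_nonneg hP (Finset.sum_nonneg fun _ _ => sq_nonneg _)
  have hsum : ∑ j ∈ s, frobNorm (Gᴴ * H j * D j) ^ 2 ≤ h * δ := by
    rw [Finset.mul_sum]
    refine Finset.sum_le_sum fun j hj => (hW j).trans ?_
    exact mul_le_mul_of_nonneg_right
      (Finset.single_le_sum (f := fun j => frobNorm (H j) ^ 2) (fun _ _ => sq_nonneg _) hj)
      (sq_nonneg _)
  have h3 : P * ∑ j ∈ s, frobNorm (Gᴴ * H j * D j) ^ 2 ≤ h * (P * δ) := by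
    calc _ ≤ P * (h * δ) := mul_le_mul_of_nonneg_left hsum hP
      _ = _ := by ring
  have h0 : 0 ≤ P * ∑ j ∈ s, frobNorm (Gᴴ * H j * D j) ^ 2 :=
    mul_nonneg hP (Finset.sum_nonneg fun _ _ => sq_nonneg _)
  rw [htr] at h2
  have h4 : (1 + (P : ℂ) • ∑ j ∈ s, (Gᴴ * H j * D j) * (Gᴴ * H j * D j)ᴴ).det.re ≤
      ((1 + h) * (1 + P * δ)) ^ Fintype.card n := by
    refine h2.trans (pow_le_pow_left₀ (by linarith) ?_ _)
    nlinarith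
  rw [← Real.log_mul (by linarith) (by linarith), ← Real.log_pow]
  exact Real.log_le_log (by simp only [Complex.one_re] at h1; linarith) h4

/-- Pointwise comparison of the rate integrand with its interference-free counterpart. -/
lemma log_det_rate_bounds {m k : Type*} [Fintype m] [Fintype k] [DecidableEq k]
    [DecidableEq n]     {P : ℝ} (hP : 0 ≤ P) (s : Finset ι)
    (G : Matrix a n ℂ) (hG : frobNorm G = 1) (H : ∀ j, Matrix a (b j) ℂ)
    (V W : ∀ j, Matrix (b j) (c j) ℂ) (hV : ∀ j ∈ s, Gᴴ * H j * V j = 0)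
    (F : Matrix a m ℂ) (U : Matrix m k ℂ) (Rb : Matrix n n ℂ)
    (hRb : Rb = 1 + (P : ℂ) • ∑ j ∈ s, Gᴴ * H j * W j * (W j)ᴴ * (H j)ᴴ * G) :
    Real.log (1 + (P : ℂ) • (Gᴴ * F * U * Uᴴ * Fᴴ * G)).det.re -
        Fintype.card n * (Real.log (1 + ∑ j ∈ s, frobNorm (H j) ^ 2) +
          Real.log (1 + P * ∑ j ∈ s, frobNorm (W j - V j) ^ 2)) ≤
      Real.log (1 + (P : ℂ) • (Rb⁻¹ * Gᴴ * F * U * Uᴴ * Fᴴ * G)).det.re ∧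
    Real.log (1 + (P : ℂ) • (Rb⁻¹ * Gᴴ * F * U * Uᴴ * Fᴴ * G)).det.re ≤
      Real.log (1 + (P : ℂ) • (Gᴴ * F * U * Uᴴ * Fᴴ * G)).det.re := by
  have hA := posSemidef_smul_sum_mul_conjTranspose hP s fun j => Gᴴ * H j * (W j - V j)
  have hR : Rb = 1 + (P : ℂ) • ∑ j ∈ s,
      (Gᴴ * H j * (W j - V j)) * (Gᴴ * H j * (W j - V j))ᴴ := by
    rw [hRb]
    congr 2
    refine Finset.sum_congr rfl fun j hj => ?_
    rw [Matrix.mul_sub, hV j hj, sub_zero]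
    simp [conjTranspose_mul, Matrix.mul_assoc]
  have hY : (P : ℂ) • (Gᴴ * F * U * Uᴴ * Fᴴ * G) =
      ((Real.sqrt P : ℂ) • (Gᴴ * F * U)) * ((Real.sqrt P : ℂ) • (Gᴴ * F * U))ᴴ := by
    have hs := Real.mul_self_sqrt hP
    simp [conjTranspose_smul, conjTranspose_mul, Matrix.mul_assoc, smul_smul, hs]
  have hYR : (P : ℂ) • (Rb⁻¹ * Gᴴ * F * U * Uᴴ * Fᴴ * G) =
      Rb⁻¹ * (((Real.sqrt P : ℂ) • (Gᴴ * F * U)) * ((Real.sqrt P : ℂ) • (Gᴴ * F * U))ᴴ) := by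
    rw [← hY, Matrix.mul_smul]
    simp only [Matrix.mul_assoc]
  have hlog := log_det_interference_le hP s G hG H fun j => W j - V j
  rw [hYR, hY]
  obtain ⟨h1, h2, h3⟩ := det_one_add_inv_mul_bounds hA ((Real.sqrt P : ℂ) • (Gᴴ * F * U))
  rw [← hR] at h1 h2 h3 hlog
  have hpos : 0 < Rb.det.re := by
    by_contra hneg
    nlinarith
  have h4 := Real.log_le_log (by linarith) h3
  rw [Real.log_mul hpos.ne' (by linarith)] at h4
  exact ⟨by linarith, Real.log_le_log (by linarith) h2⟩

end Channel

lemma eventually_log_one_add_mul_sum_le {ι : Type*} (s : Finset ι) (e : ι → ℝ → ℝ) (β : ι → ℝ)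
    (h0 : ∀ j P, 0 ≤ e j P)
    (he : ∀ j ∈ s, Tendsto (fun P => Real.log (e j P) / Real.log P) atTop (nhds (-β j)))
    {b ε : ℝ} (hb : ∀ j ∈ s, b ≤ β j) (hb1 : b ≤ 1) (hε : 0 < ε) :
    ∀ᶠ P in atTop, Real.log (1 + P * ∑ j ∈ s, e j P) / Real.log P ≤
      Real.log (1 + s.card) / Real.log P + (1 - b + ε) := by
  have hev : ∀ᶠ P in atTop, ∀ j ∈ s, e j P ≤ P ^ (-b + ε) := by
    rw [eventually_all_finset]
    exact fun j hj => eventually_le_rpow_of_tendsto_log_div_log (h0 j) (he j hj)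
      (by linarith [hb j hj])
  filter_upwards [hev, eventually_gt_atTop 1] with P hP h1
  have hP0 : 0 < P := by linarith
  have hl := Real.log_pos h1
  have hsum : ∑ j ∈ s, e j P ≤ s.card * P ^ (-b + ε) := by
    rw [← nsmul_eq_mul]
    exact Finset.sum_le_card_nsmul _ _ _ hP
  have hmul : P * P ^ (-b + ε) = P ^ (1 - b + ε) := by
    rw [show 1 - b + ε = 1 + (-b + ε) by ring, Real.rpow_add hP0 1, Real.rpow_one]
  have hone : 1 ≤ P ^ (1 - b + ε) := Real.one_le_rpow h1.le (by linarith)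
  have hle : 1 + P * ∑ j ∈ s, e j P ≤ (1 + s.card) * P ^ (1 - b + ε) := by
    have := mul_le_mul_of_nonneg_left hsum hP0.le
    rw [mul_left_comm, hmul] at this
    linarith
  have hpos : 0 < 1 + P * ∑ j ∈ s, e j P := by
    have := mul_nonneg hP0.le (Finset.sum_nonneg fun j (_ : j ∈ s) => h0 j P)
    linarith
  have hlog := Real.log_le_log hpos hle
  rw [Real.log_mul (by positivity) (by positivity), Real.log_rpow hP0] at hlog
  rw [div_add' _ _ _ hl.ne']
  exact div_le_div_of_nonneg_right hlog hl.le

/-- Proposition 2 of the paper: In the `K`-user MIMO interference channel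
with distributed CSIT, if the precoders satisfy `E[‖ΔU_j(P)‖_F²] ≐ P^{-β_j}` with
`β_j ∈ [0,1]`, then the rate `R_i(P)` of each user `i` satisfies
`liminf_{P→∞} R_i(P)/log P ≥ d_i · min_{j ≠ i} β_j`. -/
theorem stmt_0
    {Ω : Type*} [MeasurableSpace Ω] (μ : Measure Ω) [IsProbabilityMeasure μ]
    (K : ℕ) (hK : 2 ≤ K) (N M d : Fin K → ℕ)
    -- random channel matrices `H i j : Ω → ℂ^{N i × M j}`, measurable entrywise
    (H : ∀ i j : Fin K, Ω → Matrix (Fin (N i)) (Fin (M j)) ℂ)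
    (hHmeas : ∀ i j a b, Measurable fun ω => H i j ω a b)
    -- receive filters `G i : Ω → ℂ^{N i × d i}`, measurable, unit Frobenius norm a.s.
    (G : ∀ i : Fin K, Ω → Matrix (Fin (N i)) (Fin (d i)) ℂ)
    (hGmeas : ∀ i a b, Measurable fun ω => G i ω a b)
    (hGnorm : ∀ᵐ ω ∂μ, ∀ i, frobNorm (G i ω) = 1)
    -- perfect-CSIT precoders `U⋆ j`, measurable, satisfying IA almost surely
    (Ustar : ∀ j : Fin K, Ω → Matrix (Fin (M j)) (Fin (d j)) ℂ)
    (hUstarmeas : ∀ j a b, Measurable fun ω => Ustar j ω a b)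
    (hIA : ∀ᵐ ω ∂μ, ∀ i j : Fin K, i ≠ j → (G i ω)ᴴ * H i j ω * Ustar j ω = 0)
    -- imperfect precoders `U P j` for every `P > 1`, measurable
    (U : ℝ → ∀ j : Fin K, Ω → Matrix (Fin (M j)) (Fin (d j)) ℂ)
    (hUmeas : ∀ (P : ℝ), 1 < P → ∀ j a b, Measurable fun ω => U P j ω a b)
    -- (i) CSIT accuracy exponents: `E[‖U P j − U⋆ j‖_F²] ≐ P^{-β j}` with `β j ∈ [0,1]`
    (β : Fin K → ℝ) (hβ : ∀ j, β j ∈ Set.Icc (0 : ℝ) 1)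
    (hΔint : ∀ j, ∀ (P : ℝ), 1 < P →
      Integrable (fun ω => frobNorm (U P j ω - Ustar j ω) ^ 2) μ)
    (hΔ : ∀ j, Tendsto
      (fun P : ℝ => Real.log (∫ ω, frobNorm (U P j ω - Ustar j ω) ^ 2 ∂μ) / Real.log P)
      atTop (nhds (-β j)))
    -- (ii) `E[log (1 + ∑_{j≠i} ‖H i j‖_F²)] < ∞`
    (hHint : ∀ i, Integrable
      (fun ω => Real.log (1 + ∑ j ∈ Finset.univ.erase i, frobNorm (H i j ω) ^ 2)) μ)
    -- (iii) the interference-free term has full prelog `d i`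
    (hfull : ∀ i, Tendsto (fun P : ℝ =>
        (∫ ω, Real.log ((1 + (P : ℂ) • ((G i ω)ᴴ * H i i ω * U P i ω * (U P i ω)ᴴ *
            (H i i ω)ᴴ * G i ω)).det.re) ∂μ) / Real.log P)
      atTop (nhds (d i : ℝ)))
    -- the interference-plus-noise covariance `R̄_i(P)`
    (Rbar : ℝ → ∀ i : Fin K, Ω → Matrix (Fin (d i)) (Fin (d i)) ℂ)
    (hRbar : ∀ (P : ℝ) (i : Fin K) (ω : Ω), Rbar P i ω =
      1 + (P : ℂ) • ∑ j ∈ Finset.univ.erase i,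
        (G i ω)ᴴ * H i j ω * U P j ω * (U P j ω)ᴴ * (H i j ω)ᴴ * G i ω)
    -- the rate `R_i(P)`
    (R : ℝ → Fin K → ℝ)
    (hR : ∀ (P : ℝ) (i : Fin K), R P i = ∫ ω, Real.log
      ((1 + (P : ℂ) • ((Rbar P i ω)⁻¹ * (G i ω)ᴴ * H i i ω * U P i ω * (U P i ω)ᴴ *
          (H i i ω)ᴴ * G i ω)).det.re) ∂μ)
    -- (iv) all the expectations involved exist and are finite
    (hiv : ∀ (P : ℝ), 1 < P → ∀ i : Fin K,
      Integrable (fun ω => Real.log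
        ((1 + (P : ℂ) • ((Rbar P i ω)⁻¹ * (G i ω)ᴴ * H i i ω * U P i ω * (U P i ω)ᴴ *
            (H i i ω)ᴴ * G i ω)).det.re)) μ ∧
      Integrable (fun ω => Real.log
        ((1 + (P : ℂ) • ((G i ω)ᴴ * H i i ω * U P i ω * (U P i ω)ᴴ *
            (H i i ω)ᴴ * G i ω)).det.re)) μ) :
    ∀ i : Fin K, (d i : ℝ) * (⨅ j : {j : Fin K // j ≠ i}, β (j : Fin K)) ≤
      liminf (fun P : ℝ => R P i / Real.log P) atTop := by
  intro i
  set s := Finset.univ.erase i with hs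
  set b := ⨅ j : {j : Fin K // j ≠ i}, β (j : Fin K) with hb
  have hbj : ∀ j ∈ s, b ≤ β j := fun j hj =>
    ciInf_le (Finite.bddBelow_range _) (⟨j, Finset.ne_of_mem_erase hj⟩ : {j : Fin K // j ≠ i})
  have hb1 : b ≤ 1 := by
    have : Nontrivial (Fin K) := Fin.nontrivial_iff_two_le.mpr hK
    obtain ⟨j, hj⟩ := exists_ne i
    exact (hbj j (Finset.mem_erase.mpr ⟨hj, Finset.mem_univ j⟩)).trans (hβ j).2
  set e : Fin K → ℝ → ℝ := fun j P => ∫ ω, frobNorm (U P j ω - Ustar j ω) ^ 2 ∂μ with he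
  have he0 : ∀ j P, 0 ≤ e j P := fun j P => integral_nonneg fun ω => sq_nonneg _
  set h := ∫ ω, Real.log (1 + ∑ j ∈ s, frobNorm (H i j ω) ^ 2) ∂μ with hh
  set f : ℝ → ℝ := fun P => ∫ ω, Real.log ((1 + (P : ℂ) • ((G i ω)ᴴ * H i i ω * U P i ω *
    (U P i ω)ᴴ * (H i i ω)ᴴ * G i ω)).det.re) ∂μ with hf
  have hbounds : ∀ P : ℝ, 1 < P → ∀ᵐ ω ∂μ, _ := fun P hP => by
    filter_upwards [hGnorm, hIA] with ω hg hia
    have := log_det_rate_bounds (zero_le_one.trans hP.le) s (G i ω) (hg i)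
      (fun j => H i j ω) (fun j => Ustar j ω) (fun j => U P j ω)
      (fun j hj => hia i j (Finset.ne_of_mem_erase hj).symm)
      (H i i ω) (U P i ω) (Rbar P i ω) (hRbar P i ω)
    rw [Fintype.card_fin] at this
    exact this
  have hup : ∀ P : ℝ, 1 < P → R P i ≤ f P := fun P hP => by
    rw [hR]
    refine integral_mono_ae (hiv P hP i).1 (hiv P hP i).2 ?_
    filter_upwards [hbounds P hP] with ω hω using hω.2
  have hlow : ∀ P : ℝ, 1 < P →
      f P - d i * (h + Real.log (1 + P * ∑ j ∈ s, e j P)) ≤ R P i := fun P hP => by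
    have hP0 : 0 ≤ P := zero_le_one.trans hP.le
    have hX : Integrable (fun ω => P * ∑ j ∈ s, frobNorm (U P j ω - Ustar j ω) ^ 2) μ :=
      (integrable_finsetSum s fun j _ => hΔint j P hP).const_mul P
    have hX0 : ∀ ω, 0 ≤ P * ∑ j ∈ s, frobNorm (U P j ω - Ustar j ω) ^ 2 := fun ω =>
      mul_nonneg hP0 (Finset.sum_nonneg fun _ _ => sq_nonneg _)
    have hJ := integral_log_one_add_le hX hX0
    rw [integral_const_mul, integral_finsetSum s fun j _ => hΔint j P hP] at hJ
    have hL := integrable_log_one_add hX hX0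
    have hint := ((hHint i).add hL).const_mul (d i : ℝ)
    have hmono := integral_mono_ae ((hiv P hP i).2.sub hint) (hiv P hP i).1
      ((hbounds P hP).mono fun ω hω => hω.1)
    rw [← hR, integral_sub' (hiv P hP i).2 hint, integral_const_mul,
      integral_add' (hHint i) hL] at hmono
    refine le_trans ?_ hmono
    have := mul_le_mul_of_nonneg_left (add_le_add_right hJ h) (Nat.cast_nonneg (α := ℝ) (d i))
    exact sub_le_sub_left this _
  have hcob : IsCoboundedUnder (· ≥ ·) atTop fun P : ℝ => R P i / Real.log P := by
    refine IsCoboundedUnder.of_frequently_le (a := (d i : ℝ) + 1) (Eventually.frequently ?_)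
    filter_upwards [(hfull i).eventually (eventually_lt_nhds (lt_add_one _)),
      eventually_gt_atTop 1] with P hP h1
    exact (div_le_div_of_nonneg_right (hup P h1) (Real.log_pos h1).le).trans hP.le
  refine le_of_forall_lt_imp_le_of_dense fun c hc => le_liminf_of_le hcob ?_
  have hd : (0 : ℝ) < d i + 1 := by positivity
  set ε := (d i * b - c) / (d i + 1) with hεdef
  have hε : 0 < ε := div_pos (sub_pos.mpr hc) hd
  have hεd : ε * (d i + 1) = d i * b - c := div_mul_cancel₀ _ hd.ne'
  have hlog : ∀ x : ℝ, Tendsto (fun P => x / Real.log P) atTop (nhds 0) := fun x =>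
    Real.tendsto_log_atTop.const_div_atTop x
  have hlim : Tendsto (fun P => f P / Real.log P - d i * (h / Real.log P +
      (Real.log (1 + s.card) / Real.log P + (1 - b + ε)))) atTop
      (nhds (d i - d i * (0 + (0 + (1 - b + ε))))) :=
    (hfull i).sub (((hlog h).add ((hlog _).add_const _)).const_mul _)
  have hclt : c < d i - d i * (0 + (0 + (1 - b + ε))) := by nlinarith
  filter_upwards [hlim.eventually (eventually_gt_nhds hclt), eventually_gt_atTop 1,
    eventually_log_one_add_mul_sum_le s e β he0 (fun j _ => hΔ j) hbj hb1 hε] with P hP h1 hJ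
  have hl := Real.log_pos h1
  have hdiv := div_le_div_of_nonneg_right (hlow P h1) hl.le
  rw [sub_div, mul_div_assoc, add_div] at hdiv
  have := mul_le_mul_of_nonneg_left hJ (Nat.cast_nonneg (α := ℝ) (d i))
  linarith
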